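/- If the hypergraph 𝒜 ⊆ 𝒫_f(I) has the weak intersection property, then the reduced presheaf V̄ (the free presheaf quotiented by constants) satisfies condition (G). -/

import Mathlib

universe u v w

/-- The product set `E_α = Π_{i ∈ α} E_i`. -/
def EProd {I : Type u} (E : I → Type w) (α : Finset I) : Type (max u w) :=
  ∀ i : α, E i.1

/-- The projection `π^{βα} : E_α → E_β` for `β ⊆ α`. -/
def resE {I : Type u} (E : I → Type w) {α β : Finset I} (h : β ⊆ α) :
    EProd E α → EProd E β :=
  fun f i => f ⟨i.1, h i.2⟩

/-- The injection `j_{αβ} : V_β → V_α` of the free presheaf, given by precomposition with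
`π^{βα}`; here `V_α = K^{E_α}`. -/
def jmap {I : Type u} (E : I → Type w) (K : Type v) [Field K] {α β : Finset I}
    (h : β ⊆ α) : (EProd E β → K) →ₗ[K] (EProd E α → K) where
  toFun g := g ∘ resE E h
  map_add' _ _ := rfl
  map_smul' _ _ := rfl

/-- The inclusion of constants `K → K^{E_α}`. -/
def constLin {I : Type u} (E : I → Type w) (K : Type v) [Field K] (α : Finset I) :
    K →ₗ[K] (EProd E α → K) where
  toFun c := fun _ => c
  map_add' _ _ := rfl
  map_smul' _ _ := rfl

/-- The one-dimensional subspace `K_α ⊆ V_α` of constant functions. -/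
def constSub {I : Type u} (E : I → Type w) (K : Type v) [Field K] (α : Finset I) :
    Submodule K (EProd E α → K) :=
  LinearMap.range (constLin E K α)

/-- The reduced space `V̄_α = V_α / K_α`. -/
abbrev Vbar {I : Type u} (E : I → Type w) (K : Type v) [Field K] (α : Finset I) :=
  (EProd E α → K) ⧸ constSub E K α

/-- The induced injective map `j̄_{αβ} : V̄_β → V̄_α` of the reduced presheaf. -/
def jbar {I : Type u} (E : I → Type w) (K : Type v) [Field K] {α β : Finset I}
    (h : β ⊆ α) : Vbar E K β →ₗ[K] Vbar E K α :=
  Submodule.mapQ (constSub E K β) (constSub E K α) (jmap E K h)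
    (by rintro x ⟨c, rfl⟩; exact ⟨c, rfl⟩)

/-- Condition (G) for the reduced presheaf `V̄` on the hypergraph `𝒜 ⊆ 𝒫_f(I)`. -/
def ReducedConditionG {I : Type u} (A : Set (Finset I)) (E : I → Type w) (K : Type v)
    [Field K] : Prop :=
  ∀ α ∈ A, ∀ β ∈ A, ∀ h : β ⊆ α,
    LinearMap.range (jbar E K h) ⊓
        (⨆ (γ : Finset I) (hγ : γ ∈ A ∧ γ ⊆ α ∧ γ ≠ α ∧ ¬ β ⊆ γ),
          LinearMap.range (jbar E K hγ.2.1))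
      ≤ ⨆ (γ : Finset I) (hγ : γ ∈ A ∧ γ ⊆ α ∧ γ ≠ α ∧ γ ⊆ β ∧ γ ≠ β),
          LinearMap.range (jbar E K hγ.2.1)

/-- The self-map of `E_α` that keeps the coordinates in `β` and replaces the others by those of
the base point `e`. -/
def resetOutside {I : Type u} [DecidableEq I] {E : I → Type w} (e : ∀ i, E i)
    (α β : Finset I) : EProd E α → EProd E α :=
  fun x i => if i.1 ∈ β then x i else e i.1

/-- The endomorphism of `V̄_α` induced by precomposition with `resetOutside e α β`. -/
def resetBar {I : Type u} [DecidableEq I] {E : I → Type w} (K : Type v) [Field K]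
    (e : ∀ i, E i) (α β : Finset I) : Vbar E K α →ₗ[K] Vbar E K α :=
  Submodule.mapQ (constSub E K α) (constSub E K α)
    (LinearMap.funLeft K K (resetOutside e α β))
    (by rintro x ⟨c, rfl⟩; exact ⟨c, rfl⟩)

lemma resetBar_jbar_self {I : Type u} [DecidableEq I] {E : I → Type w} {K : Type v} [Field K]
    (e : ∀ i, E i) {α β : Finset I} (h : β ⊆ α) (x : Vbar E K β) :
    resetBar K e α β (jbar E K h x) = jbar E K h x := by
  obtain ⟨g, rfl⟩ := Submodule.Quotient.mk_surjective _ x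
  refine congrArg (Submodule.Quotient.mk (p := constSub E K α)) (funext fun y => congrArg g ?_)
  exact funext fun i => if_pos i.2

/-- On functions depending only on the coordinates in `γ`, the endomorphism `resetBar K e α β`
takes values in the functions depending only on the coordinates in `γ ∩ β`. -/
lemma resetBar_jbar_mem_range_inter {I : Type u} [DecidableEq I] {E : I → Type w} {K : Type v}
    [Field K] (e : ∀ i, E i) {α β γ : Finset I} (h : γ ⊆ α) (h' : γ ∩ β ⊆ α) (x : Vbar E K γ) :
    resetBar K e α β (jbar E K h x) ∈ LinearMap.range (jbar E K h') := by
  obtain ⟨g, rfl⟩ := Submodule.Quotient.mk_surjective _ x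
  let extend : EProd E (γ ∩ β) → EProd E γ := fun y i =>
    if hi : i.1 ∈ β then y ⟨i.1, Finset.mem_inter.2 ⟨i.2, hi⟩⟩ else e i.1
  refine ⟨Submodule.Quotient.mk (g ∘ extend), ?_⟩
  refine congrArg (Submodule.Quotient.mk (p := constSub E K α)) (funext fun y => congrArg g ?_)
  funext i
  by_cases hi : i.1 ∈ β <;> simp [extend, resE, resetOutside, hi]

/-- The image of `V̄_∅ = 0` in `V̄_α` is trivial. -/
lemma range_jbar_of_eq_empty {I : Type u} {E : I → Type w} {K : Type v} [Field K]
    {α β : Finset I} (h : β ⊆ α) (hβ : β = ∅) : LinearMap.range (jbar E K h) = ⊥ := by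
  subst hβ
  rw [eq_bot_iff]
  rintro _ ⟨x, rfl⟩
  obtain ⟨g, rfl⟩ := Submodule.Quotient.mk_surjective _ x
  refine (Submodule.Quotient.mk_eq_zero (constSub E K α)).2
    ⟨g fun i => absurd i.2 (Finset.notMem_empty _), ?_⟩
  exact funext fun y => congrArg g (funext fun i => absurd i.2 (Finset.notMem_empty _))

/-- If the hypergraph `𝒜 ⊆ 𝒫_f(I)` has the weak intersection property,
then the reduced presheaf `V̄` (the free presheaf quotiented by constants) satisfies
condition (G). -/
theorem weakIntersection_reducedConditionG {I : Type u} [DecidableEq I]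
    (A : Set (Finset I)) (E : I → Type w) [∀ i, Nonempty (E i)] (K : Type v) [Field K]
    (hweak : ∀ α ∈ A, ∀ α' ∈ A, (α ∩ α').Nonempty → α ∩ α' ∈ A) :
    ReducedConditionG A E K := by
  intro α _ β hβ h x ⟨⟨z, hz⟩, hx⟩
  let e : ∀ i, E i := fun i => Classical.arbitrary (E i)
  have hfix : resetBar K e α β x = x := hz ▸ resetBar_jbar_self e h z
  have hmem := Submodule.mem_map_of_mem (f := resetBar K e α β) hx
  rw [hfix] at hmem
  refine (?_ : Submodule.map (resetBar K e α β) _ ≤ _) hmem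
  simp only [Submodule.map_iSup]
  refine iSup₂_le fun γ hγ => ?_
  obtain ⟨hγA, hγα, -, hβγ⟩ := hγ
  have hne : γ ∩ β ≠ β := fun heq => hβγ (Finset.inter_eq_right.1 heq)
  have hsub : γ ∩ β ⊆ α := Finset.inter_subset_right.trans h
  have hle : Submodule.map (resetBar K e α β) (LinearMap.range (jbar E K hγα)) ≤
      LinearMap.range (jbar E K hsub) := by
    rintro _ ⟨_, ⟨y, rfl⟩, rfl⟩
    exact resetBar_jbar_mem_range_inter e hγα hsub y
  refine hle.trans ?_
  rcases (γ ∩ β).eq_empty_or_nonempty with hempty | hnonempty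
  · rw [range_jbar_of_eq_empty hsub hempty]
    exact bot_le
  · have hneα : γ ∩ β ≠ α := fun heq =>
      hne (Finset.inter_subset_right.antisymm (heq ▸ h))
    exact le_iSup₂_of_le (γ ∩ β)
      ⟨hweak γ hγA β hβ hnonempty, hsub, hneα, Finset.inter_subset_right, hne⟩ le_rfl
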